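/- Let P be a probability measure on ℝ^d. For each x ∈ ℝ^d let π(x,·) : [0,1] → (0,∞) be a continuous probability density, and let ρ(x,t,a) ≥ 0 and v(x,t,a) be C¹ in (t,a) ∈ [0,1]² such that each ρ(x,t,·) is a probability density on [0,1], ρ(x,0,·) = π(x,·), the continuity equation ∂_t ρ + ∂_a(ρ v) = 0 holds on [0,1]², and ρ·v vanishes at a = 0 and a = 1. Set r(x,t,a) = ρ(x,t,a)/π(x,a) and F(s) = ∫₀^s ∫_{ℝ^d} ( ∫₀¹ ρ(x,t,a)²/π(x,a) da ) dP(x) dt for s ∈ [0,1]. Assume the dominations needed to interchange d/dt with the x-integral hold (e.g., sup_{t,a} |∂_a r(x,t,a)| and sup_{t,a} |v(x,t,a)| are square-integrable in x under P). Then F(s) ≤ 1 + (2/√3) · sup_{u ∈ [0,s]} ( ∫ sup_{a ∈ [0,1]} |∂_a r(x,u,a)|² dP(x) )^{1/2} · ( ∫₀^s ∫_{ℝ^d} ∫₀¹ v(x,t,a)² ρ(x,t,a) da dP(x) dt )^{1/2}. -/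

import Mathlib

open MeasureTheory

section

open Set Filter Topology

/-- Partial derivatives of a `C¹` function on the closed unit square. -/
lemma ContDiffOn.exists_partial_unitSquare {f : ℝ → ℝ → ℝ}
    (hf : ContDiffOn ℝ 1 (fun z : ℝ × ℝ => f z.1 z.2) (Icc 0 1 ×ˢ Icc 0 1)) :
    ∃ ft fa : ℝ → ℝ → ℝ,
      ContinuousOn (Function.uncurry ft) (Icc 0 1 ×ˢ Icc 0 1) ∧
      ContinuousOn (Function.uncurry fa) (Icc 0 1 ×ˢ Icc 0 1) ∧
      (∀ t ∈ Icc (0:ℝ) 1, ∀ a ∈ Icc (0:ℝ) 1,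
        HasDerivWithinAt (fun s => f s a) (ft t a) (Icc 0 1) t) ∧
      (∀ t ∈ Icc (0:ℝ) 1, ∀ a ∈ Icc (0:ℝ) 1,
        HasDerivWithinAt (fun b => f t b) (fa t a) (Icc 0 1) a) := by
  set S : Set (ℝ × ℝ) := Icc 0 1 ×ˢ Icc 0 1 with hS
  have hU : UniqueDiffOn ℝ S :=
    (uniqueDiffOn_Icc zero_lt_one).prod (uniqueDiffOn_Icc zero_lt_one)
  have hc := hf.continuousOn_fderivWithin hU le_rfl
  refine ⟨fun t a => fderivWithin ℝ (fun z : ℝ × ℝ => f z.1 z.2) S (t, a) (1, 0),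
    fun t a => fderivWithin ℝ (fun z : ℝ × ℝ => f z.1 z.2) S (t, a) (0, 1),
    hc.clm_apply continuousOn_const, hc.clm_apply continuousOn_const, ?_, ?_⟩
  · intro t ht a ha
    have h := (hf.differentiableOn one_ne_zero (t, a) ⟨ht, ha⟩).hasFDerivWithinAt
    have h2 : HasDerivWithinAt (fun s : ℝ => (s, a)) (1, 0) (Icc 0 1) t :=
      (hasDerivWithinAt_id t _).prodMk (hasDerivWithinAt_const _ _ _)
    exact HasFDerivWithinAt.comp_hasDerivWithinAt t h h2 (fun s hs => mk_mem_prod hs ha)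
  · intro t ht a ha
    have h := (hf.differentiableOn one_ne_zero (t, a) ⟨ht, ha⟩).hasFDerivWithinAt
    have h2 : HasDerivWithinAt (fun b : ℝ => (t, b)) (0, 1) (Icc 0 1) a :=
      (hasDerivWithinAt_const _ _ _).prodMk (hasDerivWithinAt_id a _)
    exact HasFDerivWithinAt.comp_hasDerivWithinAt a h h2 (fun s hs => mk_mem_prod ht hs)

lemma ContinuousOn.intervalIntegral_unitSquare {f : ℝ → ℝ → ℝ}
    (hf : ContinuousOn (Function.uncurry f) (Icc 0 1 ×ˢ Icc 0 1)) :
    ContinuousOn (fun t => ∫ a in (0:ℝ)..1, f t a) (Icc 0 1) := by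
  have hp : Continuous (fun t : ℝ => (projIcc (0:ℝ) 1 zero_le_one t : ℝ)) :=
    continuous_subtype_val.comp continuous_projIcc
  have h1 : Continuous (Function.uncurry fun t a : ℝ =>
      f (projIcc (0:ℝ) 1 zero_le_one t) (projIcc (0:ℝ) 1 zero_le_one a)) :=
    hf.comp_continuous ((hp.comp continuous_fst).prodMk (hp.comp continuous_snd))
      (fun z => ⟨Subtype.coe_prop _, Subtype.coe_prop _⟩)
  refine (intervalIntegral.continuous_parametric_intervalIntegral_of_continuous'
    (μ := volume) h1 0 1).continuousOn.congr fun t ht => ?_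
  refine intervalIntegral.integral_congr fun a ha => ?_
  rw [uIcc_of_le zero_le_one] at ha
  simp only [projIcc_of_mem zero_le_one ht, projIcc_of_mem zero_le_one ha]

lemma ContinuousOn.slice_unitSquare {f : ℝ → ℝ → ℝ}
    (hf : ContinuousOn (Function.uncurry f) (Icc 0 1 ×ˢ Icc 0 1)) {t : ℝ} (ht : t ∈ Icc (0:ℝ) 1) :
    ContinuousOn (f t) (Icc 0 1) :=
  hf.comp (f := fun a : ℝ => (t, a)) (by fun_prop) (fun _ ha => ⟨ht, ha⟩)

lemma intervalIntegrable_unitInterval {f : ℝ → ℝ} (hf : ContinuousOn f (Icc 0 1)) {a b : ℝ}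
    (ha : a ∈ Icc (0:ℝ) 1) (hb : b ∈ Icc (0:ℝ) 1) : IntervalIntegrable f volume a b :=
  (hf.mono (ordConnected_Icc.uIcc_subset ha hb)).intervalIntegrable

lemma eqOn_unitSquare_of_interior {f g : ℝ → ℝ → ℝ}
    (hf : ContinuousOn (Function.uncurry f) (Icc 0 1 ×ˢ Icc 0 1))
    (hg : ContinuousOn (Function.uncurry g) (Icc 0 1 ×ˢ Icc 0 1))
    (h : ∀ t ∈ Ioo (0:ℝ) 1, ∀ a ∈ Ioo (0:ℝ) 1, f t a = g t a) :
    ∀ t ∈ Icc (0:ℝ) 1, ∀ a ∈ Icc (0:ℝ) 1, f t a = g t a := by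
  have key : EqOn (Function.uncurry f) (Function.uncurry g) (Icc 0 1 ×ˢ Icc 0 1) := by
    refine EqOn.of_subset_closure (s := Ioo (0:ℝ) 1 ×ˢ Ioo (0:ℝ) 1)
      (fun z hz => h z.1 hz.1 z.2 hz.2) hf hg
      (prod_mono Ioo_subset_Icc_self Ioo_subset_Icc_self) ?_
    rw [closure_prod_eq, closure_Ioo zero_ne_one]
  exact fun t ht a ha => key (show (t, a) ∈ _ from ⟨ht, ha⟩)

/-- Evolution of `∫ ρ_t² / ρ_0 = 1 + χ²(ρ_t‖ρ_0)` along the continuity equation. -/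
lemma integral_sq_div_of_continuityEquation {p : ℝ → ℝ} {ρ v : ℝ → ℝ → ℝ}
    (hp_pos : ∀ a ∈ Icc (0:ℝ) 1, 0 < p a)
    (hp_dens : ∫ a in (0:ℝ)..1, p a = 1)
    (hρ : ContDiffOn ℝ 1 (fun z : ℝ × ℝ => ρ z.1 z.2) (Icc 0 1 ×ˢ Icc 0 1))
    (hv : ContDiffOn ℝ 1 (fun z : ℝ × ℝ => v z.1 z.2) (Icc 0 1 ×ˢ Icc 0 1))
    (hinit : ∀ a ∈ Icc (0:ℝ) 1, ρ 0 a = p a)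
    (hce : ∀ t ∈ Icc (0:ℝ) 1, ∀ a ∈ Icc (0:ℝ) 1,
      deriv (fun s => ρ s a) t + deriv (fun b => ρ t b * v t b) a = 0)
    (hbd : ∀ t ∈ Icc (0:ℝ) 1, ρ t 0 * v t 0 = 0 ∧ ρ t 1 * v t 1 = 0) :
    ∃ ra : ℝ → ℝ → ℝ, ContinuousOn (Function.uncurry ra) (Icc 0 1 ×ˢ Icc 0 1) ∧
      (∀ t ∈ Icc (0:ℝ) 1, ∀ a ∈ Icc (0:ℝ) 1,
        HasDerivWithinAt (fun b => ρ t b / p b) (ra t a) (Icc 0 1) a) ∧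
      ∀ t ∈ Icc (0:ℝ) 1, ∫ a in (0:ℝ)..1, ρ t a ^ 2 / p a =
        1 + ∫ τ in (0:ℝ)..t, ∫ a in (0:ℝ)..1, 2 * (ra τ a * (ρ τ a * v τ a)) := by
  obtain ⟨ρt, ρa, hρtc, hρac, hρt, hρa⟩ := hρ.exists_partial_unitSquare
  obtain ⟨vt, va, hvtc, hvac, hvt, hva⟩ := hv.exists_partial_unitSquare
  have h0 : (0:ℝ) ∈ Icc (0:ℝ) 1 := by simp
  have h1 : (1:ℝ) ∈ Icc (0:ℝ) 1 := by simp
  have hρc : ContinuousOn (Function.uncurry ρ) (Icc 0 1 ×ˢ Icc 0 1) := hρ.continuousOn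
  have hvc : ContinuousOn (Function.uncurry v) (Icc 0 1 ×ˢ Icc 0 1) := hv.continuousOn
  have hpd : ∀ a ∈ Icc (0:ℝ) 1, HasDerivWithinAt p (ρa 0 a) (Icc 0 1) a := fun a ha =>
    (hρa 0 h0 a ha).congr (fun b hb => (hinit b hb).symm) (hinit a ha).symm
  have hpc : ContinuousOn (Function.uncurry fun _ a : ℝ => p a) (Icc 0 1 ×ˢ Icc 0 1) :=
    ContinuousOn.comp (g := p) (t := Icc 0 1) (fun a ha => (hpd a ha).continuousWithinAt)
      continuousOn_snd (fun z hz => hz.2)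
  have hρa0c : ContinuousOn (Function.uncurry fun _ a : ℝ => ρa 0 a) (Icc 0 1 ×ˢ Icc 0 1) :=
    ContinuousOn.comp (g := ρa 0) (hρac.slice_unitSquare h0)
      continuousOn_snd (fun z hz => hz.2)
  have hp0 : ∀ z ∈ Icc (0:ℝ) 1 ×ˢ Icc (0:ℝ) 1, (Function.uncurry fun _ a : ℝ => p a) z ≠ 0 :=
    fun z hz => (hp_pos z.2 hz.2).ne'
  set ra : ℝ → ℝ → ℝ := fun t a => (ρa t a * p a - ρ t a * ρa 0 a) / p a ^ 2 with hra
  have hrac : ContinuousOn (Function.uncurry ra) (Icc 0 1 ×ˢ Icc 0 1) :=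
    ((hρac.mul hpc).sub (hρc.mul hρa0c)).div (hpc.pow 2) (fun z hz => pow_ne_zero 2 (hp0 z hz))
  have hrd : ∀ t ∈ Icc (0:ℝ) 1, ∀ a ∈ Icc (0:ℝ) 1,
      HasDerivWithinAt (fun b => ρ t b / p b) (ra t a) (Icc 0 1) a := fun t ht a ha =>
    (hρa t ht a ha).div (hpd a ha) (hp_pos a ha).ne'
  have hflux : ∀ t ∈ Icc (0:ℝ) 1, ∀ a ∈ Icc (0:ℝ) 1,
      HasDerivWithinAt (fun b => ρ t b * v t b) (ρa t a * v t a + ρ t a * va t a) (Icc 0 1) a :=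
    fun t ht a ha => (hρa t ht a ha).mul (hva t ht a ha)
  have hfc : ContinuousOn (Function.uncurry fun t a => ρa t a * v t a + ρ t a * va t a)
      (Icc 0 1 ×ˢ Icc 0 1) := (hρac.mul hvc).add (hρc.mul hvac)
  have hce' : ∀ t ∈ Icc (0:ℝ) 1, ∀ a ∈ Icc (0:ℝ) 1,
      ρt t a = - (ρa t a * v t a + ρ t a * va t a) := by
    refine eqOn_unitSquare_of_interior hρtc hfc.neg fun t ht a ha => ?_
    have ht' := Ioo_subset_Icc_self ht
    have ha' := Ioo_subset_Icc_self ha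
    have e := hce t ht' a ha'
    rw [((hρt t ht' a ha').hasDerivAt (Icc_mem_nhds ht.1 ht.2)).deriv,
      ((hflux t ht' a ha').hasDerivAt (Icc_mem_nhds ha.1 ha.2)).deriv] at e
    linarith
  refine ⟨ra, hrac, hrd, fun t ht => ?_⟩
  have hsub : uIcc 0 t ⊆ Icc (0:ℝ) 1 := ordConnected_Icc.uIcc_subset h0 ht
  have hgc : ContinuousOn (Function.uncurry fun τ a => 2 * (ρ τ a / p a) * ρt τ a)
      (Icc 0 1 ×ˢ Icc 0 1) := (continuousOn_const.mul (hρc.div hpc hp0)).mul hρtc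
  have hpc1 : ContinuousOn p (Icc 0 1) := fun a ha => (hpd a ha).continuousWithinAt
  have hq : ContinuousOn (fun a => ρ t a ^ 2 / p a) (Icc 0 1) :=
    ((hρc.slice_unitSquare ht).pow 2).div hpc1 fun a ha => (hp_pos a ha).ne'
  have htime : ∀ a ∈ Icc (0:ℝ) 1,
      ρ t a ^ 2 / p a - p a = ∫ τ in (0:ℝ)..t, 2 * (ρ τ a / p a) * ρt τ a := by
    intro a ha
    have hpa := (hp_pos a ha).ne'
    have hd : ∀ τ ∈ Icc (0:ℝ) 1,
        HasDerivWithinAt (fun s => ρ s a ^ 2 / p a) (2 * (ρ τ a / p a) * ρt τ a) (Icc 0 1) τ := by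
      intro τ hτ
      refine (((hρt τ hτ a ha).pow 2).div_const (p a)).congr_deriv ?_
      simp only [Nat.cast_ofNat, Nat.add_one_sub_one, pow_one]
      ring
    rw [intervalIntegral.integral_eq_sub_of_hasDerivAt_of_le
      (f := fun s => ρ s a ^ 2 / p a) ht.1]
    · simp only [hinit a ha]
      field_simp
    · exact fun τ hτ => (hd τ ⟨hτ.1, hτ.2.trans ht.2⟩).continuousWithinAt.mono
        (Icc_subset_Icc_right ht.2)
    · exact fun τ hτ => (hd τ ⟨hτ.1.le, hτ.2.le.trans ht.2⟩).hasDerivAt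
        (Icc_mem_nhds hτ.1 (hτ.2.trans_le ht.2))
    · exact intervalIntegrable_unitInterval (hgc.comp (f := fun τ : ℝ => (τ, a)) (by fun_prop)
        (fun _ hτ => ⟨hτ, ha⟩)) h0 ht
  have hspace : ∀ τ ∈ Icc (0:ℝ) 1, ∫ a in (0:ℝ)..1, 2 * (ρ τ a / p a) * ρt τ a =
      ∫ a in (0:ℝ)..1, 2 * (ra τ a * (ρ τ a * v τ a)) := by
    intro τ hτ
    have hby := intervalIntegral.integral_mul_deriv_eq_deriv_mul_of_hasDerivWithinAt
      (a := 0) (b := 1) (u := fun a => ρ τ a / p a) (v := fun a => ρ τ a * v τ a)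
      (u' := ra τ) (v' := fun a => ρa τ a * v τ a + ρ τ a * va τ a)
      (by rw [uIcc_of_le zero_le_one]; exact hrd τ hτ)
      (by rw [uIcc_of_le zero_le_one]; exact hflux τ hτ)
      (intervalIntegrable_unitInterval (hrac.slice_unitSquare hτ) h0 h1)
      (intervalIntegrable_unitInterval (hfc.slice_unitSquare hτ) h0 h1)
    rw [(hbd τ hτ).1, (hbd τ hτ).2, mul_zero, mul_zero, sub_zero, zero_sub] at hby
    rw [intervalIntegral.integral_const_mul, ← neg_eq_iff_eq_neg.mpr hby, ← mul_neg_one,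
      mul_comm _ (-1 : ℝ), ← mul_assoc, ← intervalIntegral.integral_const_mul]
    refine intervalIntegral.integral_congr fun a ha => ?_
    rw [uIcc_of_le zero_le_one] at ha
    simp only [hce' τ hτ a ha]
    ring
  have hdiff : (∫ a in (0:ℝ)..1, ρ t a ^ 2 / p a) - 1 =
      ∫ a in (0:ℝ)..1, ∫ τ in (0:ℝ)..t, 2 * (ρ τ a / p a) * ρt τ a := by
    nth_rewrite 2 [← hp_dens]
    rw [← intervalIntegral.integral_sub (intervalIntegrable_unitInterval hq h0 h1)
      (intervalIntegrable_unitInterval hpc1 h0 h1)]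
    refine intervalIntegral.integral_congr fun a ha => ?_
    rw [uIcc_of_le zero_le_one] at ha
    exact htime a ha
  rw [← intervalIntegral_intervalIntegral_swap (F := fun τ a => 2 * (ρ τ a / p a) * ρt τ a)] at hdiff
  · rw [← sub_eq_iff_eq_add', hdiff]
    exact intervalIntegral.integral_congr fun τ hτ => hspace τ (hsub hτ)
  · refine IntegrableOn.mono_set (t := Icc (0:ℝ) 1 ×ˢ Icc (0:ℝ) 1)
      (hgc.integrableOn_compact (isCompact_Icc.prod isCompact_Icc)) (prod_mono ?_ ?_)
    · exact uIoc_subset_uIcc.trans hsub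
    · exact uIoc_subset_uIcc.trans (by rw [uIcc_of_le zero_le_one])

lemma integral_const_add_primitive {w : ℝ → ℝ} (hw : ContinuousOn w (Icc 0 1)) (c : ℝ) {s : ℝ}
    (hs : s ∈ Icc (0:ℝ) 1) :
    ∫ t in (0:ℝ)..s, (c + ∫ τ in (0:ℝ)..t, w τ) = c * s + ∫ τ in (0:ℝ)..s, (s - τ) * w τ := by
  have h0 : (0:ℝ) ∈ Icc (0:ℝ) 1 := by simp
  have hsub : uIcc 0 s ⊆ Icc (0:ℝ) 1 := ordConnected_Icc.uIcc_subset h0 hs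
  set W : ℝ → ℝ := fun t => w (projIcc (0:ℝ) 1 zero_le_one t) with hWdef
  have hW : Continuous W :=
    hw.comp_continuous (continuous_subtype_val.comp continuous_projIcc)
      (fun t => Subtype.coe_prop _)
  have hWw : ∀ t ∈ Icc (0:ℝ) 1, w t = W t := fun t ht => by
    simp only [hWdef, projIcc_of_mem zero_le_one ht]
  have e1 : ∫ t in (0:ℝ)..s, (c + ∫ τ in (0:ℝ)..t, w τ) =
      ∫ t in (0:ℝ)..s, (c + ∫ τ in (0:ℝ)..t, W τ) := by
    refine intervalIntegral.integral_congr fun t ht => ?_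
    simp only [add_right_inj]
    exact intervalIntegral.integral_congr fun τ hτ =>
      hWw τ (ordConnected_Icc.uIcc_subset h0 (hsub ht) hτ)
  have e2 : ∫ τ in (0:ℝ)..s, (s - τ) * w τ = ∫ τ in (0:ℝ)..s, (s - τ) * W τ :=
    intervalIntegral.integral_congr fun τ hτ => by simp only [hWw τ (hsub hτ)]
  rw [e1, e2]
  have hby := intervalIntegral.integral_mul_deriv_eq_deriv_mul (a := 0) (b := s)
    (u := fun t => t - s) (u' := fun _ => 1) (v := fun t => c + ∫ τ in (0:ℝ)..t, W τ) (v' := W)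
    (fun t _ => (hasDerivAt_id t).sub_const s)
    (fun t _ => (hW.integral_hasStrictDerivAt 0 t).hasDerivAt.const_add c)
    intervalIntegrable_const (hW.intervalIntegrable _ _)
  have e3 : ∫ τ in (0:ℝ)..s, (s - τ) * W τ = - ∫ τ in (0:ℝ)..s, (τ - s) * W τ := by
    rw [← intervalIntegral.integral_neg]
    exact intervalIntegral.integral_congr fun τ _ => by ring
  rw [e3, hby]
  simp only [one_mul, sub_self, zero_mul, intervalIntegral.integral_same, add_zero]
  ring

/-- Weighted Young bound for the time-integrated chi-square functional. -/
lemma integral_const_add_primitive_le {ρ v ra : ℝ → ℝ → ℝ}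
    (hρ : ContinuousOn (Function.uncurry ρ) (Icc 0 1 ×ˢ Icc 0 1))
    (hv : ContinuousOn (Function.uncurry v) (Icc 0 1 ×ˢ Icc 0 1))
    (hra : ContinuousOn (Function.uncurry ra) (Icc 0 1 ×ˢ Icc 0 1))
    (hρ0 : ∀ t ∈ Icc (0:ℝ) 1, ∀ a ∈ Icc (0:ℝ) 1, 0 ≤ ρ t a)
    {s c : ℝ} (hs : s ∈ Icc (0:ℝ) 1) (hc : 0 < c) :
    ∫ t in (0:ℝ)..s, (1 + ∫ τ in (0:ℝ)..t, ∫ a in (0:ℝ)..1, 2 * (ra τ a * (ρ τ a * v τ a))) ≤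
      s + c * (∫ τ in (0:ℝ)..s, (s - τ) ^ 2 * ∫ a in (0:ℝ)..1, ra τ a ^ 2 * ρ τ a) +
        c⁻¹ * ∫ τ in (0:ℝ)..s, ∫ a in (0:ℝ)..1, v τ a ^ 2 * ρ τ a := by
  have h0 : (0:ℝ) ∈ Icc (0:ℝ) 1 := by simp
  have h1 : (1:ℝ) ∈ Icc (0:ℝ) 1 := by simp
  have hW : ContinuousOn (Function.uncurry fun τ a => 2 * (ra τ a * (ρ τ a * v τ a)))
      (Icc 0 1 ×ˢ Icc 0 1) := continuousOn_const.mul (hra.mul (hρ.mul hv))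
  have hA : ContinuousOn (Function.uncurry fun τ a => ra τ a ^ 2 * ρ τ a)
      (Icc 0 1 ×ˢ Icc 0 1) := (hra.pow 2).mul hρ
  have hB : ContinuousOn (Function.uncurry fun τ a => v τ a ^ 2 * ρ τ a)
      (Icc 0 1 ×ˢ Icc 0 1) := (hv.pow 2).mul hρ
  have hAc := hA.intervalIntegral_unitSquare
  have hBc := hB.intervalIntegral_unitSquare
  have hWc := hW.intervalIntegral_unitSquare
  have hAi : IntervalIntegrable
      (fun τ => (s - τ) ^ 2 * ∫ a in (0:ℝ)..1, ra τ a ^ 2 * ρ τ a) volume 0 s :=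
    intervalIntegrable_unitInterval ((by fun_prop : Continuous fun τ : ℝ =>
      (s - τ) ^ 2).continuousOn.mul hAc) h0 hs
  have hBi := intervalIntegrable_unitInterval hBc h0 hs
  rw [integral_const_add_primitive hWc 1 hs, one_mul, add_assoc,
    ← intervalIntegral.integral_const_mul, ← intervalIntegral.integral_const_mul,
    ← intervalIntegral.integral_add (hAi.const_mul c) (hBi.const_mul c⁻¹)]
  refine add_le_add le_rfl (intervalIntegral.integral_mono_on hs.1 ?_
    ((hAi.const_mul c).add (hBi.const_mul c⁻¹)) fun τ hτ => ?_)
  · exact intervalIntegrable_unitInterval ((by fun_prop : Continuous fun τ : ℝ =>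
      (s - τ)).continuousOn.mul hWc) h0 hs
  have hτ' : τ ∈ Icc (0:ℝ) 1 := ⟨hτ.1, hτ.2.trans hs.2⟩
  have hAi' := intervalIntegrable_unitInterval (hA.slice_unitSquare hτ') h0 h1
  have hBi' := intervalIntegrable_unitInterval (hB.slice_unitSquare hτ') h0 h1
  have hWi' := intervalIntegrable_unitInterval (hW.slice_unitSquare hτ') h0 h1
  rw [← mul_assoc, ← intervalIntegral.integral_const_mul, ← intervalIntegral.integral_const_mul,
    ← intervalIntegral.integral_const_mul,
    ← intervalIntegral.integral_add (hAi'.const_mul _) (hBi'.const_mul _)]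
  refine intervalIntegral.integral_mono_on zero_le_one (hWi'.const_mul _)
    ((hAi'.const_mul _).add (hBi'.const_mul _)) fun a ha => ?_
  have hρa := hρ0 τ hτ' a ha
  have hy : 0 ≤ c⁻¹ * (c * ((s - τ) * ra τ a) - v τ a) ^ 2 * ρ τ a := by positivity
  have hid : c⁻¹ * (c * ((s - τ) * ra τ a) - v τ a) ^ 2 * ρ τ a =
      c * (s - τ) ^ 2 * (ra τ a ^ 2 * ρ τ a) + c⁻¹ * (v τ a ^ 2 * ρ τ a) -
        (s - τ) * (2 * (ra τ a * (ρ τ a * v τ a))) := by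
    field_simp
    ring
  linarith

/-- Pointwise bounds for the chi-square functional and its right-hand side terms. -/
lemma one_add_primitive_le {ρ v ra : ℝ → ℝ → ℝ}
    (hρ : ContinuousOn (Function.uncurry ρ) (Icc 0 1 ×ˢ Icc 0 1))
    (hv : ContinuousOn (Function.uncurry v) (Icc 0 1 ×ˢ Icc 0 1))
    (hra : ContinuousOn (Function.uncurry ra) (Icc 0 1 ×ˢ Icc 0 1))
    (hρ0 : ∀ t ∈ Icc (0:ℝ) 1, ∀ a ∈ Icc (0:ℝ) 1, 0 ≤ ρ t a)
    (hρ1 : ∀ t ∈ Icc (0:ℝ) 1, ∫ a in (0:ℝ)..1, ρ t a = 1) {M V : ℝ}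
    (hM : ∀ t ∈ Icc (0:ℝ) 1, ∀ a ∈ Ioo (0:ℝ) 1, ra t a ^ 2 ≤ M)
    (hV : ∀ t ∈ Icc (0:ℝ) 1, ∀ a ∈ Ioo (0:ℝ) 1, v t a ^ 2 ≤ V)
    {t : ℝ} (ht : t ∈ Icc (0:ℝ) 1) :
    1 + ∫ τ in (0:ℝ)..t, ∫ a in (0:ℝ)..1, 2 * (ra τ a * (ρ τ a * v τ a)) ≤ 1 + (M + V) := by
  have h0 : (0:ℝ) ∈ Icc (0:ℝ) 1 := by simp
  have h1 : (1:ℝ) ∈ Icc (0:ℝ) 1 := by simp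
  have hW : ContinuousOn (Function.uncurry fun τ a => 2 * (ra τ a * (ρ τ a * v τ a)))
      (Icc 0 1 ×ˢ Icc 0 1) := continuousOn_const.mul (hra.mul (hρ.mul hv))
  have hmid : (1 / 2 : ℝ) ∈ Ioo (0:ℝ) 1 := by norm_num
  have hMV : 0 ≤ M + V :=
    add_nonneg ((sq_nonneg _).trans (hM 0 h0 _ hmid)) ((sq_nonneg _).trans (hV 0 h0 _ hmid))
  have hin : ∀ τ ∈ Icc (0:ℝ) 1, ∫ a in (0:ℝ)..1, 2 * (ra τ a * (ρ τ a * v τ a)) ≤ M + V := by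
    intro τ hτ
    have hρi := intervalIntegrable_unitInterval (hρ.slice_unitSquare hτ) h0 h1
    calc _ ≤ ∫ a in (0:ℝ)..1, (M + V) * ρ τ a := by
          refine intervalIntegral.integral_mono_on_of_le_Ioo zero_le_one
            (intervalIntegrable_unitInterval (hW.slice_unitSquare hτ) h0 h1)
            (hρi.const_mul _) fun a ha => ?_
          have e1 := hM τ hτ a ha
          have e2 := hV τ hτ a ha
          have e3 : 2 * (ra τ a * v τ a) ≤ M + V := by nlinarith [sq_nonneg (ra τ a - v τ a)]
          nlinarith [mul_le_mul_of_nonneg_right e3 (hρ0 τ hτ a (Ioo_subset_Icc_self ha))]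
      _ = M + V := by rw [intervalIntegral.integral_const_mul, hρ1 τ hτ, mul_one]
  refine add_le_add le_rfl ?_
  calc _ ≤ ∫ τ in (0:ℝ)..t, (M + V) := by
        refine intervalIntegral.integral_mono_on ht.1
          (intervalIntegrable_unitInterval hW.intervalIntegral_unitSquare h0 ht)
          intervalIntegrable_const fun τ hτ => hin τ ⟨hτ.1, hτ.2.trans ht.2⟩
    _ ≤ M + V := by
        rw [intervalIntegral.integral_const, smul_eq_mul, sub_zero]
        exact mul_le_of_le_one_left hMV ht.2

lemma integral_mul_le_of_density {f q : ℝ → ℝ} (hf : ContinuousOn f (Icc 0 1))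
    (hq : ContinuousOn q (Icc 0 1)) (hq0 : ∀ a ∈ Icc (0:ℝ) 1, 0 ≤ q a)
    (hq1 : ∫ a in (0:ℝ)..1, q a = 1) {M : ℝ} (hM : ∀ a ∈ Ioo (0:ℝ) 1, f a ≤ M) :
    ∫ a in (0:ℝ)..1, f a * q a ≤ M := by
  have h0 : (0:ℝ) ∈ Icc (0:ℝ) 1 := by simp
  have h1 : (1:ℝ) ∈ Icc (0:ℝ) 1 := by simp
  calc _ ≤ ∫ a in (0:ℝ)..1, M * q a := by
        refine intervalIntegral.integral_mono_on_of_le_Ioo zero_le_one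
          (intervalIntegrable_unitInterval (hf.mul hq) h0 h1)
          ((intervalIntegrable_unitInterval hq h0 h1).const_mul _) fun a ha => ?_
        exact mul_le_mul_of_nonneg_right (hM a ha) (hq0 a (Ioo_subset_Icc_self ha))
    _ = M := by rw [intervalIntegral.integral_const_mul, hq1, mul_one]

lemma le_two_mul_sqrt_of_forall_young {y B K : ℝ} (hB : 0 ≤ B) (hK : 0 ≤ K)
    (h : ∀ c : ℝ, 0 < c → y ≤ c * B + c⁻¹ * K) : y ≤ 2 * (√B * √K) := by
  have key : ∀ ε : ℝ, 0 < ε → y ≤ 2 * ((√B + ε) * (√K + ε)) := by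
    intro ε hε
    have hb : 0 < √B + ε := by positivity
    have hk : 0 < √K + ε := by positivity
    have h2 := h ((√K + ε) / (√B + ε)) (by positivity)
    have e1 : B ≤ (√B + ε) ^ 2 := by nlinarith [Real.sq_sqrt hB, Real.sqrt_nonneg B]
    have e2 : K ≤ (√K + ε) ^ 2 := by nlinarith [Real.sq_sqrt hK, Real.sqrt_nonneg K]
    refine h2.trans ?_
    calc _ ≤ (√K + ε) / (√B + ε) * (√B + ε) ^ 2 + ((√K + ε) / (√B + ε))⁻¹ * (√K + ε) ^ 2 := by
          gcongr
      _ = _ := by field_simp; ring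
  have hlim : Tendsto (fun ε : ℝ => 2 * ((√B + ε) * (√K + ε))) (𝓝[>] 0)
      (𝓝 (2 * (√B * √K))) := by
    have : Continuous fun ε : ℝ => 2 * ((√B + ε) * (√K + ε)) := by fun_prop
    simpa using (this.tendsto 0).mono_left nhdsWithin_le_nhds
  exact ge_of_tendsto hlim (eventually_mem_nhdsWithin.mono fun ε hε => key ε hε)

lemma abs_deriv_le_of_hasDerivWithinAt {f : ℝ → ℝ} {f' a : ℝ}
    (h : HasDerivWithinAt f f' (Icc 0 1) a) (ha : a ∈ Icc (0:ℝ) 1) : |deriv f a| ≤ |f'| := by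
  by_cases hd : DifferentiableAt ℝ f a
  · rw [(uniqueDiffOn_Icc zero_lt_one a ha).eq_deriv _ hd.hasDerivAt.hasDerivWithinAt h]
  · rw [deriv_zero_of_not_differentiableAt hd, abs_zero]
    exact abs_nonneg _

lemma le_biSup_real {ι : Type*} {S : Set ι} {f : ι → ℝ} {C : ℝ} (hf : ∀ u ∈ S, f u ≤ C)
    (hC : 0 ≤ C) {u : ι} (hu : u ∈ S) : f u ≤ ⨆ u ∈ S, f u := by
  have hb : BddAbove (range fun u => ⨆ _ : u ∈ S, f u) := by
    refine ⟨C, ?_⟩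
    rintro _ ⟨w, rfl⟩
    exact Real.iSup_le (fun hw => hf w hw) hC
  refine le_ciSup_of_le hb u ?_
  rw [ciSup_pos hu]

lemma biSup_real_le {ι : Type*} {S : Set ι} {f : ι → ℝ} {C : ℝ} (hf : ∀ u ∈ S, f u ≤ C)
    (hC : 0 ≤ C) : ⨆ u ∈ S, f u ≤ C :=
  Real.iSup_le (fun w => Real.iSup_le (fun hw => hf w hw) hC) hC

lemma biSup_real_nonneg {ι : Type*} {S : Set ι} {f : ι → ℝ} (hf : ∀ u ∈ S, 0 ≤ f u) :
    0 ≤ ⨆ u ∈ S, f u :=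
  Real.iSup_nonneg fun w => Real.iSup_nonneg fun hw => hf w hw

/-- A bounded function on the unit square is dominated by its iterated supremum. -/
lemma le_biSup_biSup_unitSquare {f : ℝ → ℝ → ℝ} {C : ℝ}
    (hC : ∀ t ∈ Icc (0:ℝ) 1, ∀ a ∈ Icc (0:ℝ) 1, f t a ≤ C) (hC0 : 0 ≤ C) {t a : ℝ}
    (ht : t ∈ Icc (0:ℝ) 1) (ha : a ∈ Icc (0:ℝ) 1) :
    f t a ≤ ⨆ t ∈ Icc (0:ℝ) 1, ⨆ a ∈ Icc (0:ℝ) 1, f t a :=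
  (le_biSup_real (hC t ht) hC0 ha).trans
    (le_biSup_real (f := fun t => ⨆ a ∈ Icc (0:ℝ) 1, f t a)
      (fun t ht => biSup_real_le (hC t ht) hC0) hC0 ht)

/-- The supremum of the squared derivative over the closed interval is a countable supremum. -/
lemma biSup_sq_deriv_eq_iSup_rat {f g : ℝ → ℝ} (hg : ContinuousOn g (Icc 0 1))
    (hfg : ∀ a ∈ Icc (0:ℝ) 1, HasDerivWithinAt f (g a) (Icc 0 1) a) :
    ⨆ a ∈ Icc (0:ℝ) 1, deriv f a ^ 2 =
      ⨆ q : ℚ, (Ioo (0:ℝ) 1).indicator (deriv f) q ^ 2 := by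
  obtain ⟨C, hC⟩ := isCompact_Icc.exists_bound_of_continuousOn hg
  have hd : ∀ a ∈ Icc (0:ℝ) 1, deriv f a ^ 2 ≤ g a ^ 2 := fun a ha =>
    sq_le_sq.2 (abs_deriv_le_of_hasDerivWithinAt (hfg a ha) ha)
  have hgC : ∀ a ∈ Icc (0:ℝ) 1, g a ^ 2 ≤ C ^ 2 := fun a ha => by
    rw [← sq_abs (g a)]
    exact pow_le_pow_left₀ (abs_nonneg _) (hC a ha) 2
  have hdC : ∀ a ∈ Icc (0:ℝ) 1, deriv f a ^ 2 ≤ C ^ 2 := fun a ha => (hd a ha).trans (hgC a ha)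
  have hnn : 0 ≤ ⨆ q : ℚ, (Ioo (0:ℝ) 1).indicator (deriv f) q ^ 2 :=
    Real.iSup_nonneg fun q => sq_nonneg _
  apply le_antisymm
  · refine biSup_real_le (fun a ha => (hd a ha).trans ?_) hnn
    have hcl : Icc (0:ℝ) 1 ⊆ closure (Ioo (0:ℝ) 1 ∩ range ((↑) : ℚ → ℝ)) := by
      rw [← closure_Ioo zero_ne_one]
      exact closure_minimal (Rat.denseRange_cast.open_subset_closure_inter isOpen_Ioo)
        isClosed_closure
    have hcl' : closure (Ioo (0:ℝ) 1 ∩ range ((↑) : ℚ → ℝ)) ⊆ Icc 0 1 :=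
      closure_minimal (inter_subset_left.trans Ioo_subset_Icc_self) isClosed_Icc
    refine le_on_closure (f := fun a => g a ^ 2) (g := fun _ => _) ?_ ((hg.mono hcl').pow 2)
      continuousOn_const (hcl ha)
    rintro _ ⟨hq, q, rfl⟩
    have hb : BddAbove (range fun q : ℚ => (Ioo (0:ℝ) 1).indicator (deriv f) q ^ 2) := by
      refine ⟨C ^ 2, ?_⟩
      rintro _ ⟨q, rfl⟩
      by_cases hq : (q : ℝ) ∈ Ioo (0:ℝ) 1
      · simpa only [indicator_of_mem hq] using hdC q (Ioo_subset_Icc_self hq)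
      · simpa only [indicator_of_notMem hq, zero_pow two_ne_zero] using sq_nonneg C
    refine le_ciSup_of_le hb q ?_
    rw [indicator_of_mem hq,
      ((hfg q (Ioo_subset_Icc_self hq)).hasDerivAt (Icc_mem_nhds hq.1 hq.2)).deriv]
  · refine Real.iSup_le (fun q => ?_) (biSup_real_nonneg fun _ _ => sq_nonneg _)
    by_cases hq : (q : ℝ) ∈ Ioo (0:ℝ) 1
    · rw [indicator_of_mem hq]
      exact le_biSup_real (f := fun a => deriv f a ^ 2) hdC (sq_nonneg C) (Ioo_subset_Icc_self hq)
    · rw [indicator_of_notMem hq, zero_pow two_ne_zero]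
      exact biSup_real_nonneg fun _ _ => sq_nonneg _

lemma measurable_indicator_deriv_last {Ω : Type*} [MeasurableSpace Ω] {f : Ω → ℝ → ℝ → ℝ}
    (hf : Measurable fun z : Ω × ℝ × ℝ => f z.1 z.2.1 z.2.2)
    (hd : ∀ x, ∀ t ∈ Icc (0:ℝ) 1, ∀ a ∈ Ioo (0:ℝ) 1, DifferentiableAt ℝ (f x t) a) :
    Measurable fun z : Ω × ℝ × ℝ => (Icc (0:ℝ) 1).indicator
      (fun t => (Ioo (0:ℝ) 1).indicator (deriv (f z.1 t)) z.2.2) z.2.1 := by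
  set S : Set (Ω × ℝ × ℝ) := {z | z.2.1 ∈ Icc (0:ℝ) 1 ∧ z.2.2 ∈ Ioo (0:ℝ) 1} with hS
  have hSm : MeasurableSet S :=
    (measurable_snd.fst measurableSet_Icc).inter (measurable_snd.snd measurableSet_Ioo)
  refine measurable_of_tendsto_metrizable (f := fun (n : ℕ) => S.indicator fun z : Ω × ℝ × ℝ =>
    (1 / ((n : ℝ) + 1))⁻¹ * (f z.1 z.2.1 (z.2.2 + 1 / ((n : ℝ) + 1)) - f z.1 z.2.1 z.2.2))
    (fun n => ?_) ?_
  · refine Measurable.indicator ?_ hSm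
    refine Measurable.const_mul (Measurable.sub ?_ hf) _
    exact hf.comp (g := fun z : Ω × ℝ × ℝ => f z.1 z.2.1 z.2.2)
      (f := fun z : Ω × ℝ × ℝ => (z.1, z.2.1, z.2.2 + 1 / ((n : ℝ) + 1))) (by fun_prop)
  · rw [tendsto_pi_nhds]
    rintro ⟨x, t, a⟩
    by_cases ht : t ∈ Icc (0:ℝ) 1
    · by_cases ha : a ∈ Ioo (0:ℝ) 1
      · have hz : (x, t, a) ∈ S := ⟨ht, ha⟩
        simp only [indicator_of_mem hz, indicator_of_mem ht, indicator_of_mem ha]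
        refine ((hd x t ht a ha).hasDerivAt.tendsto_slope_zero_right).comp
          (tendsto_nhdsWithin_iff.2 ⟨tendsto_one_div_add_atTop_nhds_zero_nat, ?_⟩)
        exact Eventually.of_forall fun n => mem_Ioi.2 Nat.one_div_pos_of_nat
      · have hz : (x, t, a) ∉ S := fun h => ha h.2
        simp only [indicator_of_notMem hz, indicator_of_mem ht, indicator_of_notMem ha]
        exact tendsto_const_nhds
    · have hz : (x, t, a) ∉ S := fun h => ht h.1
      simp only [indicator_of_notMem hz, indicator_of_notMem ht]
      exact tendsto_const_nhds

lemma measurable_intervalIntegral_last {Ω : Type*} [MeasurableSpace Ω] {f : Ω → ℝ → ℝ → ℝ}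
    (hf : Measurable fun z : Ω × ℝ × ℝ => f z.1 z.2.1 z.2.2) :
    Measurable (Function.uncurry fun x t => ∫ a in (0:ℝ)..1, f x t a) := by
  have h : StronglyMeasurable (Function.uncurry fun (y : Ω × ℝ) (a : ℝ) => f y.1 y.2 a) :=
    (hf.comp (f := fun w : (Ω × ℝ) × ℝ => (w.1.1, w.1.2, w.2)) (by fun_prop)).stronglyMeasurable
  simpa only [intervalIntegral.integral_of_le zero_le_one, Function.uncurry_def] using
    (h.integral_prod_right (ν := volume.restrict (Ioc 0 1))).measurable

lemma integrable_uncurry_of_bound {Ω : Type*} [MeasurableSpace Ω] {P : Measure Ω}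
    [IsProbabilityMeasure P] {H : Ω → ℝ → ℝ} {B : Ω → ℝ} {s : ℝ} (hs : s ∈ Icc (0:ℝ) 1)
    (hH : Measurable (Function.uncurry H)) (hB : Integrable B P)
    (h0 : ∀ x, ∀ t ∈ Icc (0:ℝ) 1, 0 ≤ H x t) (h1 : ∀ x, ∀ t ∈ Icc (0:ℝ) 1, H x t ≤ B x) :
    Integrable (Function.uncurry fun t x => H x t) ((volume.restrict (Ioc 0 s)).prod P) := by
  refine (hB.comp_snd (volume.restrict (Ioc 0 s))).mono'
    (hH.comp measurable_swap).aestronglyMeasurable ?_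
  filter_upwards [Measure.quasiMeasurePreserving_fst.ae
    (ae_restrict_mem (μ := volume) (measurableSet_Ioc (a := (0:ℝ)) (b := s)))] with z hz
  have hz' : z.1 ∈ Icc (0:ℝ) 1 := ⟨hz.1.le, hz.2.trans hs.2⟩
  rw [Function.uncurry_def, Real.norm_of_nonneg (h0 _ _ hz')]
  exact h1 _ _ hz'

/-- Integrating a family of weighted Young bounds and optimizing the weight. -/
lemma integral_le_of_forall_young {Ω : Type*} [MeasurableSpace Ω] {P : Measure Ω}
    [IsProbabilityMeasure P] {G A B : Ω → ℝ → ℝ} {M V : Ω → ℝ} {s N : ℝ}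
    (hs : s ∈ Icc (0:ℝ) 1) (hN : 0 ≤ N)
    (hGm : Measurable (Function.uncurry G)) (hAm : Measurable (Function.uncurry A))
    (hBm : Measurable (Function.uncurry B)) (hM : Integrable M P) (hV : Integrable V P)
    (hG0 : ∀ x, ∀ t ∈ Icc (0:ℝ) 1, 0 ≤ G x t) (hA0 : ∀ x, ∀ t ∈ Icc (0:ℝ) 1, 0 ≤ A x t)
    (hB0 : ∀ x, ∀ t ∈ Icc (0:ℝ) 1, 0 ≤ B x t)
    (hG1 : ∀ x, ∀ t ∈ Icc (0:ℝ) 1, G x t ≤ 1 + (M x + V x))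
    (hA1 : ∀ x, ∀ t ∈ Icc (0:ℝ) 1, A x t ≤ M x)
    (hB1 : ∀ x, ∀ t ∈ Icc (0:ℝ) 1, B x t ≤ V x)
    (hAN : ∀ t ∈ Icc 0 s, ∫ x, A x t ∂P ≤ N ^ 2)
    (hyoung : ∀ x, ∀ c : ℝ, 0 < c → ∫ t in (0:ℝ)..s, G x t ≤
      s + c * (∫ t in (0:ℝ)..s, (s - t) ^ 2 * A x t) + c⁻¹ * ∫ t in (0:ℝ)..s, B x t) :
    ∫ t in (0:ℝ)..s, ∫ x, G x t ∂P ≤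
      1 + (2 / √3) * N * √(∫ t in (0:ℝ)..s, ∫ x, B x t ∂P) := by
  have hGi := integrable_uncurry_of_bound hs hGm ((integrable_const 1).add (hM.add hV)) hG0 hG1
  have hBi := integrable_uncurry_of_bound hs hBm hV hB0 hB1
  have hWm : Measurable (Function.uncurry fun (x : Ω) (t : ℝ) => (s - t) ^ 2 * A x t) :=
    (by fun_prop : Measurable fun z : Ω × ℝ => (s - z.2) ^ 2).mul hAm
  have hWi := integrable_uncurry_of_bound (P := P) (H := fun x t => (s - t) ^ 2 * A x t) hs
    hWm hM
    (fun x t ht => mul_nonneg (sq_nonneg _) (hA0 x t ht)) (fun x t ht => by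
      have e : (s - t) ^ 2 ≤ 1 := by
        rw [sq_le_one_iff_abs_le_one, abs_le]
        constructor <;> linarith [hs.1, hs.2, ht.1, ht.2]
      exact (mul_le_of_le_one_left (hA0 x t ht) e).trans (hA1 x t ht))
  have hK : 0 ≤ ∫ t in (0:ℝ)..s, ∫ x, B x t ∂P :=
    intervalIntegral.integral_nonneg hs.1 fun t ht =>
      integral_nonneg fun x => hB0 x t ⟨ht.1, ht.2.trans hs.2⟩
  have hW : ∫ t in (0:ℝ)..s, ∫ x, (s - t) ^ 2 * A x t ∂P ≤ N ^ 2 / 3 := by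
    have hint : IntervalIntegrable (fun t => ∫ x, (s - t) ^ 2 * A x t ∂P) volume 0 s := by
      rw [intervalIntegrable_iff_integrableOn_Ioc_of_le hs.1]
      exact hWi.integral_prod_left
    calc _ ≤ ∫ t in (0:ℝ)..s, (s - t) ^ 2 * N ^ 2 := by
          refine intervalIntegral.integral_mono_on hs.1 hint
            (Continuous.intervalIntegrable (by fun_prop) _ _) fun t ht => ?_
          rw [integral_const_mul]
          exact mul_le_mul_of_nonneg_left (hAN t ht) (sq_nonneg _)
      _ = s ^ 3 / 3 * N ^ 2 := by
          rw [intervalIntegral.integral_mul_const,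
            intervalIntegral.integral_comp_sub_left (fun t => t ^ 2) s, integral_pow]
          norm_num
      _ ≤ N ^ 2 / 3 := by
          have : s ^ 3 ≤ 1 := pow_le_one₀ hs.1 hs.2
          nlinarith [sq_nonneg N]
  have hswap : ∀ {H : Ω → ℝ → ℝ},
      Integrable (Function.uncurry fun t x => H x t) ((volume.restrict (Ioc 0 s)).prod P) →
      ∫ t in (0:ℝ)..s, ∫ x, H x t ∂P = ∫ x, (∫ t in (0:ℝ)..s, H x t) ∂P ∧
        Integrable (fun x => ∫ t in (0:ℝ)..s, H x t) P := by
    intro H hH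
    refine ⟨intervalIntegral_integral_swap (by rwa [uIoc_of_le hs.1]), ?_⟩
    simpa only [intervalIntegral.integral_of_le hs.1, Function.uncurry_apply_pair] using hH.integral_prod_right
  obtain ⟨eG, iG⟩ := hswap hGi
  obtain ⟨eB, iB⟩ := hswap hBi
  obtain ⟨eW, iW⟩ := hswap (H := fun x t => (s - t) ^ 2 * A x t) hWi
  have hy : ∀ c : ℝ, 0 < c → (∫ t in (0:ℝ)..s, ∫ x, G x t ∂P) - s ≤
      c * (N ^ 2 / 3) + c⁻¹ * ∫ t in (0:ℝ)..s, ∫ x, B x t ∂P := by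
    intro c hc
    have h1 : ∫ x, (∫ t in (0:ℝ)..s, G x t) ∂P ≤ ∫ x, (s +
        c * (∫ t in (0:ℝ)..s, (s - t) ^ 2 * A x t) + c⁻¹ * ∫ t in (0:ℝ)..s, B x t) ∂P :=
      integral_mono iG (((integrable_const s).add (iW.const_mul c)).add (iB.const_mul c⁻¹))
        fun x => hyoung x c hc
    have h2 := integral_add ((integrable_const s).add (iW.const_mul c)) (iB.const_mul c⁻¹)
    simp only [Pi.add_apply] at h2
    rw [h2, integral_add (integrable_const s) (iW.const_mul c), integral_const_mul, integral_const_mul,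
      integral_const, probReal_univ, one_smul, ← eG, ← eB, ← eW] at h1
    linarith [mul_le_mul_of_nonneg_left hW hc.le]
  have hfin := le_two_mul_sqrt_of_forall_young (by positivity) hK hy
  rw [Real.sqrt_div (sq_nonneg N), Real.sqrt_sq hN] at hfin
  have : 2 * (N / √3 * √(∫ t in (0:ℝ)..s, ∫ x, B x t ∂P)) =
    (2 / √3) * N * √(∫ t in (0:ℝ)..s, ∫ x, B x t ∂P) := by ring
  linarith [hs.2]

end

/-- upper bound for
`F(s) = ∫₀^s ∫ (∫₀¹ ρ(x,t,a)²/π(x,a) da) dP(x) dt = ∫₀^s (1 + E[χ²(ρ_t‖π)]) dt`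
in terms of the mixed `L₂(P)`-sup norm of `∂_a r` and the Benamou–Brenier kinetic
energy, with explicit constant `2/√3`. -/
theorem stmt_5 {d : ℕ} (P : Measure (Fin d → ℝ)) [IsProbabilityMeasure P]
    (pi : (Fin d → ℝ) → ℝ → ℝ) (ρ v : (Fin d → ℝ) → ℝ → ℝ → ℝ)
    (hmeas_pi : Measurable (Function.uncurry pi))
    (hmeas_ρ : Measurable (fun z : (Fin d → ℝ) × ℝ × ℝ => ρ z.1 z.2.1 z.2.2))
    (hmeas_v : Measurable (fun z : (Fin d → ℝ) × ℝ × ℝ => v z.1 z.2.1 z.2.2))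
    (hpi_cont : ∀ x, ContinuousOn (pi x) (Set.Icc 0 1))
    (hpi_pos : ∀ x, ∀ a ∈ Set.Icc (0:ℝ) 1, 0 < pi x a)
    (hpi_dens : ∀ x, ∫ a in (0:ℝ)..1, pi x a = 1)
    (hρ_C1 : ∀ x, ContDiffOn ℝ 1 (fun z : ℝ × ℝ => ρ x z.1 z.2)
      (Set.Icc 0 1 ×ˢ Set.Icc 0 1))
    (hv_C1 : ∀ x, ContDiffOn ℝ 1 (fun z : ℝ × ℝ => v x z.1 z.2)
      (Set.Icc 0 1 ×ˢ Set.Icc 0 1))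
    (hρ_nonneg : ∀ x, ∀ t ∈ Set.Icc (0:ℝ) 1, ∀ a ∈ Set.Icc (0:ℝ) 1, 0 ≤ ρ x t a)
    (hρ_dens : ∀ x, ∀ t ∈ Set.Icc (0:ℝ) 1, ∫ a in (0:ℝ)..1, ρ x t a = 1)
    -- the path starts at the treatment density:
    (hρ_init : ∀ x, ∀ a ∈ Set.Icc (0:ℝ) 1, ρ x 0 a = pi x a)
    -- continuity equation on [0,1]²:
    (hcont_eq : ∀ x, ∀ t ∈ Set.Icc (0:ℝ) 1, ∀ a ∈ Set.Icc (0:ℝ) 1,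
      deriv (fun s => ρ x s a) t + deriv (fun b => ρ x t b * v x t b) a = 0)
    -- vanishing boundary flux:
    (hbdry : ∀ x, ∀ t ∈ Set.Icc (0:ℝ) 1, ρ x t 0 * v x t 0 = 0 ∧ ρ x t 1 * v x t 1 = 0)
    -- dominations permitting differentiation under the P-integral:
    (hdom_r : Integrable (fun x => (⨆ t ∈ Set.Icc (0:ℝ) 1, ⨆ a ∈ Set.Icc (0:ℝ) 1,
      |deriv (fun b => ρ x t b / pi x b) a|)^2) P)
    (hdom_v : Integrable (fun x => (⨆ t ∈ Set.Icc (0:ℝ) 1, ⨆ a ∈ Set.Icc (0:ℝ) 1,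
      |v x t a|)^2) P)
    (s : ℝ) (hs : s ∈ Set.Icc (0:ℝ) 1) :
    (∫ t in (0:ℝ)..s, ∫ x, (∫ a in (0:ℝ)..1, (ρ x t a)^2 / pi x a) ∂P)
      ≤ 1 + (2 / Real.sqrt 3)
          * (⨆ u ∈ Set.Icc (0:ℝ) s, Real.sqrt
              (∫ x, (⨆ a ∈ Set.Icc (0:ℝ) 1,
                (deriv (fun b => ρ x u b / pi x b) a)^2) ∂P))
          * Real.sqrt (∫ t in (0:ℝ)..s, ∫ x,
              (∫ a in (0:ℝ)..1, (v x t a)^2 * ρ x t a) ∂P) := by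
  have I0 : (0:ℝ) ∈ Set.Icc (0:ℝ) 1 := by simp
  choose ra hrac hrd hchi using fun x => integral_sq_div_of_continuityEquation (hpi_pos x)
    (hpi_dens x) (hρ_C1 x) (hv_C1 x) (hρ_init x) (hcont_eq x) (hbdry x)
  have hρc : ∀ x, ContinuousOn (Function.uncurry (ρ x)) (Set.Icc 0 1 ×ˢ Set.Icc 0 1) :=
    fun x => (hρ_C1 x).continuousOn
  have hvc : ∀ x, ContinuousOn (Function.uncurry (v x)) (Set.Icc 0 1 ×ˢ Set.Icc 0 1) :=
    fun x => (hv_C1 x).continuousOn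
  have hder : ∀ x, ∀ t ∈ Set.Icc (0:ℝ) 1, ∀ a ∈ Set.Ioo (0:ℝ) 1,
      HasDerivAt (fun b => ρ x t b / pi x b) (ra x t a) a := fun x t ht a ha =>
    (hrd x t ht a (Set.Ioo_subset_Icc_self ha)).hasDerivAt (Icc_mem_nhds ha.1 ha.2)
  set M : (Fin d → ℝ) → ℝ := fun x => (⨆ t ∈ Set.Icc (0:ℝ) 1, ⨆ a ∈ Set.Icc (0:ℝ) 1,
    |deriv (fun b => ρ x t b / pi x b) a|) ^ 2 with hM
  set V : (Fin d → ℝ) → ℝ := fun x => (⨆ t ∈ Set.Icc (0:ℝ) 1, ⨆ a ∈ Set.Icc (0:ℝ) 1,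
    |v x t a|) ^ 2 with hV
  set D : ℝ → (Fin d → ℝ) → ℝ := fun u x => ⨆ a ∈ Set.Icc (0:ℝ) 1,
    (deriv (fun b => ρ x u b / pi x b) a) ^ 2 with hD
  set R : (Fin d → ℝ) → ℝ → ℝ → ℝ := fun x t a => (Set.Icc (0:ℝ) 1).indicator
    (fun t => (Set.Ioo (0:ℝ) 1).indicator (deriv fun b => ρ x t b / pi x b) a) t with hR
  have hdM : ∀ x, ∀ t ∈ Set.Icc (0:ℝ) 1, ∀ a ∈ Set.Icc (0:ℝ) 1,
      (deriv (fun b => ρ x t b / pi x b) a) ^ 2 ≤ M x := by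
    intro x t ht a ha
    obtain ⟨C, hC⟩ := (isCompact_Icc.prod isCompact_Icc).exists_bound_of_continuousOn (hrac x)
    rw [← sq_abs]
    refine pow_le_pow_left₀ (abs_nonneg _) (le_biSup_biSup_unitSquare
      (f := fun t a => |deriv (fun b => ρ x t b / pi x b) a|) (C := C)
      (fun t ht a ha => ?_) ((norm_nonneg _).trans (hC (0, 0) ⟨I0, I0⟩)) ht ha) 2
    exact (abs_deriv_le_of_hasDerivWithinAt (hrd x t ht a ha) ha).trans (hC (t, a) ⟨ht, ha⟩)
  have hraM : ∀ x, ∀ t ∈ Set.Icc (0:ℝ) 1, ∀ a ∈ Set.Ioo (0:ℝ) 1, ra x t a ^ 2 ≤ M x := by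
    intro x t ht a ha
    rw [← (hder x t ht a ha).deriv]
    exact hdM x t ht a (Set.Ioo_subset_Icc_self ha)
  have hvV : ∀ x, ∀ t ∈ Set.Icc (0:ℝ) 1, ∀ a ∈ Set.Icc (0:ℝ) 1, v x t a ^ 2 ≤ V x := by
    intro x t ht a ha
    obtain ⟨C, hC⟩ := (isCompact_Icc.prod isCompact_Icc).exists_bound_of_continuousOn (hvc x)
    rw [← sq_abs]
    exact pow_le_pow_left₀ (abs_nonneg _) (le_biSup_biSup_unitSquare
      (f := fun t a => |v x t a|) (C := C) (fun t ht a ha => hC (t, a) ⟨ht, ha⟩)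
      ((norm_nonneg _).trans (hC (0, 0) ⟨I0, I0⟩)) ht ha) 2
  have hRm : Measurable fun z : (Fin d → ℝ) × ℝ × ℝ => R z.1 z.2.1 z.2.2 := by
    refine measurable_indicator_deriv_last (f := fun x t a => ρ x t a / pi x a)
      (hmeas_ρ.div ?_) fun x t ht a ha => (hder x t ht a ha).differentiableAt
    exact hmeas_pi.comp (f := fun z : (Fin d → ℝ) × ℝ × ℝ => (z.1, z.2.2)) (by fun_prop)
  have hA : ∀ x, ∀ t ∈ Set.Icc (0:ℝ) 1,
      ∫ a in (0:ℝ)..1, R x t a ^ 2 * ρ x t a = ∫ a in (0:ℝ)..1, ra x t a ^ 2 * ρ x t a := by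
    intro x t ht
    simp only [intervalIntegral.integral_of_le zero_le_one, integral_Ioc_eq_integral_Ioo]
    refine setIntegral_congr_fun measurableSet_Ioo fun a ha => ?_
    simp only [hR, Set.indicator_of_mem ht, Set.indicator_of_mem ha, (hder x t ht a ha).deriv]
  have hAle : ∀ x, ∀ t ∈ Set.Icc (0:ℝ) 1, ∀ C : ℝ,
      (∀ a ∈ Set.Ioo (0:ℝ) 1, ra x t a ^ 2 ≤ C) →
      ∫ a in (0:ℝ)..1, R x t a ^ 2 * ρ x t a ≤ C := by
    intro x t ht C hC
    rw [hA x t ht]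
    exact integral_mul_le_of_density (((hrac x).slice_unitSquare ht).pow 2)
      ((hρc x).slice_unitSquare ht) (hρ_nonneg x t ht) (hρ_dens x t ht) hC
  have hA0 : ∀ x, ∀ t ∈ Set.Icc (0:ℝ) 1, 0 ≤ ∫ a in (0:ℝ)..1, R x t a ^ 2 * ρ x t a :=
    fun x t ht => intervalIntegral.integral_nonneg zero_le_one fun a ha =>
      mul_nonneg (sq_nonneg _) (hρ_nonneg x t ht a ha)
  have hDm : ∀ t ∈ Set.Icc (0:ℝ) 1, Measurable (D t) := by
    intro t ht
    have e : D t = fun x => ⨆ q : ℚ, R x t q ^ 2 := by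
      funext x
      simp only [hD, hR, Set.indicator_of_mem ht]
      exact biSup_sq_deriv_eq_iSup_rat ((hrac x).slice_unitSquare ht) (hrd x t ht)
    rw [e]
    refine Measurable.iSup fun q => Measurable.pow_const ?_ 2
    exact hRm.comp (f := fun x : Fin d → ℝ => (x, t, (q : ℝ))) (by fun_prop)
  have hD0 : ∀ t x, 0 ≤ D t x := fun t x => biSup_real_nonneg fun _ _ => sq_nonneg _
  have hDM : ∀ t ∈ Set.Icc (0:ℝ) 1, ∀ x, D t x ≤ M x := fun t ht x =>
    biSup_real_le (hdM x t ht) (sq_nonneg _)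
  have hDi : ∀ t ∈ Set.Icc (0:ℝ) 1, Integrable (D t) P := fun t ht =>
    hdom_r.mono' (hDm t ht).aestronglyMeasurable (Filter.Eventually.of_forall fun x => by
      rw [Real.norm_of_nonneg (hD0 t x)]
      exact hDM t ht x)
  have hDN : ∀ t ∈ Set.Icc (0:ℝ) s,
      √(∫ x, D t x ∂P) ≤ ⨆ u ∈ Set.Icc (0:ℝ) s, √(∫ x, D u x ∂P) := by
    intro t ht
    refine le_biSup_real (f := fun u => √(∫ x, D u x ∂P)) (C := √(∫ x, M x ∂P))
      (fun u hu => Real.sqrt_le_sqrt ?_) (Real.sqrt_nonneg _) ht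
    have hu' : u ∈ Set.Icc (0:ℝ) 1 := ⟨hu.1, hu.2.trans hs.2⟩
    exact integral_mono (hDi u hu') hdom_r (hDM u hu')
  have hAm := measurable_intervalIntegral_last (f := fun x t a => R x t a ^ 2 * ρ x t a)
    ((hRm.pow_const 2).mul hmeas_ρ)
  refine integral_le_of_forall_young (M := M) (V := V)
    (A := fun x t => ∫ a in (0:ℝ)..1, R x t a ^ 2 * ρ x t a) hs
    (biSup_real_nonneg fun _ _ => Real.sqrt_nonneg _) ?_ hAm ?_ hdom_r hdom_v ?_ hA0 ?_ ?_
    (fun x t ht => hAle x t ht _ (hraM x t ht)) ?_ ?_ ?_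
  · refine measurable_intervalIntegral_last (f := fun x t a => ρ x t a ^ 2 / pi x a)
      ((hmeas_ρ.pow_const 2).div ?_)
    exact hmeas_pi.comp (f := fun z : (Fin d → ℝ) × ℝ × ℝ => (z.1, z.2.2)) (by fun_prop)
  · exact measurable_intervalIntegral_last (f := fun x t a => v x t a ^ 2 * ρ x t a)
      ((hmeas_v.pow_const 2).mul hmeas_ρ)
  · exact fun x t ht => intervalIntegral.integral_nonneg zero_le_one fun a ha =>
      div_nonneg (sq_nonneg _) (hpi_pos x a ha).le
  · exact fun x t ht => intervalIntegral.integral_nonneg zero_le_one fun a ha =>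
      mul_nonneg (sq_nonneg _) (hρ_nonneg x t ht a ha)
  · intro x t ht
    rw [hchi x t ht]
    exact one_add_primitive_le (hρc x) (hvc x) (hrac x) (hρ_nonneg x) (hρ_dens x) (hraM x)
      (fun t ht a ha => hvV x t ht a (Set.Ioo_subset_Icc_self ha)) ht
  · exact fun x t ht => integral_mul_le_of_density (((hvc x).slice_unitSquare ht).pow 2)
      ((hρc x).slice_unitSquare ht) (hρ_nonneg x t ht) (hρ_dens x t ht)
      fun a ha => hvV x t ht a (Set.Ioo_subset_Icc_self ha)
  · intro t ht
    have ht' : t ∈ Set.Icc (0:ℝ) 1 := ⟨ht.1, ht.2.trans hs.2⟩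
    have hle : ∀ x, ∫ a in (0:ℝ)..1, R x t a ^ 2 * ρ x t a ≤ D t x := fun x =>
      hAle x t ht' _ fun a ha => by
        rw [← (hder x t ht' a ha).deriv]
        exact le_biSup_real (f := fun a => deriv (fun b => ρ x t b / pi x b) a ^ 2)
          (hdM x t ht') (sq_nonneg _) (Set.Ioo_subset_Icc_self ha)
    calc _ ≤ ∫ x, D t x ∂P :=
          integral_mono_of_nonneg (Filter.Eventually.of_forall fun x => hA0 x t ht') (hDi t ht')
            (Filter.Eventually.of_forall hle)
      _ = √(∫ x, D t x ∂P) ^ 2 := (Real.sq_sqrt (integral_nonneg (hD0 t))).symm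
      _ ≤ _ := pow_le_pow_left₀ (Real.sqrt_nonneg _) (hDN t ht) 2
  · intro x c hc
    have hsub : Set.uIcc 0 s ⊆ Set.Icc (0:ℝ) 1 := Set.ordConnected_Icc.uIcc_subset I0 hs
    rw [intervalIntegral.integral_congr fun t ht => hchi x t (hsub ht),
      intervalIntegral.integral_congr fun t ht =>
        congrArg (fun y => (s - t) ^ 2 * y) (hA x t (hsub ht))]
    exact integral_const_add_primitive_le (hρc x) (hvc x) (hrac x) (hρ_nonneg x) hs hc
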